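/- Suppose f : ℝ^l × ℝ^p → L(ℝ^l, ℝ^p) is smooth. Fix x₀ ∈ ℝ^l, y₀ ∈ ℝ^p and r ≥ 1, and define H_r := {(a, b) ∈ (ℝ^l)^r × (ℝ^p)^r : setting x(t) := x₀ + Σ_{j=1}^r a_j t^j and y(t) := y₀ + Σ_{j=1}^r b_j t^j, the map g(t) := y′(t) − f(x(t), y(t))(x′(t)) satisfies g^{(j)}(0) = 0 for all 0 ≤ j ≤ r−1}. Then H_r equals the graph {(a, J_{x₀,y₀,r}(a)) : a ∈ (ℝ^l)^r} of the jet-lifting map; in particular H_r is a smooth submanifold of (ℝ^l)^r × (ℝ^p)^r of dimension l·r, and the projection (a, b) ↦ a restricts to a homeomorphism from H_r onto (ℝ^l)^r. -/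

import Mathlib

/-- The polynomial curve `t ↦ c₀ + ∑_{j=1}^r c_j t^j` in `ℝ^d`
(indexing: `c j` is the coefficient of `t^(j+1)` for `j : Fin r`). -/
noncomputable def polyCurve {d : ℕ} (c₀ : Fin d → ℝ) {r : ℕ} (c : Fin r → (Fin d → ℝ)) :
    ℝ → (Fin d → ℝ) :=
  fun t => c₀ + ∑ j : Fin r, t ^ ((j : ℕ) + 1) • c j

/-- `IsJetLift f x₀ y₀ r a b` : setting `x t = x₀ + ∑ a_j t^j` and `y t = y₀ + ∑ b_j t^j`,
the defect `g t = y′ t − f (x t, y t) (x′ t)` vanishes to order `r` at `t = 0`. -/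
def IsJetLift {l p : ℕ}
    (f : (Fin l → ℝ) × (Fin p → ℝ) → ((Fin l → ℝ) →L[ℝ] (Fin p → ℝ)))
    (x₀ : Fin l → ℝ) (y₀ : Fin p → ℝ) (r : ℕ)
    (a : Fin r → (Fin l → ℝ)) (b : Fin r → (Fin p → ℝ)) : Prop :=
  ∀ j < r,
    iteratedDeriv j
      (fun t : ℝ =>
        deriv (polyCurve y₀ b) t
          - f (polyCurve x₀ a t, polyCurve y₀ b t) (deriv (polyCurve x₀ a) t)) 0 = 0

open scoped ContDiff

section IteratedDeriv

variable {E F G : Type*} [NormedAddCommGroup E] [NormedSpace ℝ E]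
  [NormedAddCommGroup F] [NormedSpace ℝ F] [NormedAddCommGroup G] [NormedSpace ℝ G]

/-- The iterated derivatives in the last variable of a smooth map are jointly smooth. -/
theorem ContDiff.iteratedDeriv_uncurry {g : E → ℝ → F}
    (hg : ContDiff ℝ ∞ (Function.uncurry g)) (n : ℕ) :
    ContDiff ℝ ∞ fun q : E × ℝ => iteratedDeriv n (g q.1) q.2 := by
  induction n generalizing g with
  | zero => simpa [Function.uncurry_def] using hg
  | succ n ih =>
    simp only [iteratedDeriv_succ']
    refine ih (g := fun e => deriv (g e)) ?_
    have hg' : ContDiff ℝ ∞ (Function.uncurry fun q : E × ℝ => g q.1) :=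
      hg.comp (contDiff_fst.fst.prodMk contDiff_snd)
    exact hg'.fderiv_apply contDiff_snd contDiff_const (by simp)

/-- The `n`-jet of `g ∘ u` at a point depends only on the `n`-jet of `u`. -/
theorem iteratedFDeriv_comp_congr {g : F → G} (hg : ContDiff ℝ ∞ g) {u v : E → F}
    (hu : ContDiff ℝ ∞ u) (hv : ContDiff ℝ ∞ v) {x : E} {n : ℕ}
    (h : ∀ k ≤ n, iteratedFDeriv ℝ k u x = iteratedFDeriv ℝ k v x) :
    iteratedFDeriv ℝ n (g ∘ u) x = iteratedFDeriv ℝ n (g ∘ v) x := by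
  have hn : (n : ℕ∞ω) ≤ ∞ := by exact_mod_cast le_top
  have huv : u x = v x := by simpa using congrArg (fun m => m 0) (h 0 n.zero_le)
  rw [iteratedFDeriv_comp hg.contDiffAt hu.contDiffAt hn,
    iteratedFDeriv_comp hg.contDiffAt hv.contDiffAt hn, huv]
  refine Finset.sum_congr rfl fun c _ => ?_
  refine congrArg (c.compAlongOrderedFinpartition _) (funext fun m => ?_)
  exact h _ (c.partSize_le m)

end IteratedDeriv

section PolyCurve

variable {d r : ℕ}

theorem contDiff_uncurry_polyCurve (c₀ : Fin d → ℝ) :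
    ContDiff ℝ ∞ (Function.uncurry fun c : Fin r → (Fin d → ℝ) => polyCurve c₀ c) := by
  unfold Function.uncurry polyCurve
  fun_prop

theorem contDiff_polyCurve (c₀ : Fin d → ℝ) (c : Fin r → (Fin d → ℝ)) :
    ContDiff ℝ ∞ (polyCurve c₀ c) :=
  (contDiff_uncurry_polyCurve c₀).comp (contDiff_prodMk_right c)

theorem contDiff_deriv_polyCurve (c₀ : Fin d → ℝ) :
    ContDiff ℝ ∞ fun q : (Fin r → (Fin d → ℝ)) × ℝ => deriv (polyCurve c₀ q.1) q.2 := by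
  simpa using (contDiff_uncurry_polyCurve c₀).iteratedDeriv_uncurry 1

theorem iteratedDeriv_succ_polyCurve_zero (c₀ : Fin d → ℝ) (c : Fin r → (Fin d → ℝ)) (k : ℕ) :
    iteratedDeriv (k + 1) (polyCurve c₀ c) 0 =
      ∑ j : Fin r, if k = j then ((k + 1).factorial : ℝ) • c j else 0 := by
  unfold polyCurve
  rw [iteratedDeriv_const_add k.succ_pos, iteratedDeriv_fun_sum (fun j _ => by fun_prop)]
  refine Finset.sum_congr rfl fun j _ => ?_
  rw [iteratedDeriv_smul_const (by fun_prop), iteratedDeriv_fun_pow_zero]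
  by_cases h : k = j <;> simp [h]

theorem iteratedFDeriv_polyCurve_congr (c₀ : Fin d → ℝ) {c c' : Fin r → (Fin d → ℝ)} {n : ℕ}
    (h : ∀ j : Fin r, (j : ℕ) < n → c j = c' j) {k : ℕ} (hk : k ≤ n) :
    iteratedFDeriv ℝ k (polyCurve c₀ c) 0 = iteratedFDeriv ℝ k (polyCurve c₀ c') 0 := by
  simp only [iteratedFDeriv_eq_equiv_comp, Function.comp_apply]
  congr 1
  cases k with
  | zero => simp [polyCurve]
  | succ k =>
    simp only [iteratedDeriv_succ_polyCurve_zero]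
    refine Finset.sum_congr rfl fun j _ => ?_
    split_ifs with hj
    · rw [h j (by omega)]
    · rfl

end PolyCurve

section JetLift

variable {l p r : ℕ} {f : (Fin l → ℝ) × (Fin p → ℝ) → ((Fin l → ℝ) →L[ℝ] (Fin p → ℝ))}

theorem contDiff_uncurry_lift_velocity (hf : ContDiff ℝ ∞ f) (x₀ : Fin l → ℝ) (y₀ : Fin p → ℝ) :
    ContDiff ℝ ∞ (Function.uncurry
      fun (z : (Fin r → (Fin l → ℝ)) × (Fin r → (Fin p → ℝ))) (t : ℝ) =>
        f (polyCurve x₀ z.1 t, polyCurve y₀ z.2 t) (deriv (polyCurve x₀ z.1) t)) := by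
  have h₁ : ContDiff ℝ ∞ fun q : ((Fin r → (Fin l → ℝ)) × (Fin r → (Fin p → ℝ))) × ℝ =>
      (q.1.1, q.2) := by fun_prop
  have h₂ : ContDiff ℝ ∞ fun q : ((Fin r → (Fin l → ℝ)) × (Fin r → (Fin p → ℝ))) × ℝ =>
      (q.1.2, q.2) := by fun_prop
  exact (hf.comp (((contDiff_uncurry_polyCurve x₀).comp h₁).prodMk
    ((contDiff_uncurry_polyCurve y₀).comp h₂))).clm_apply ((contDiff_deriv_polyCurve x₀).comp h₁)

/-- The `n`-th derivative at `0` of `f (x, y) x'` involves only the coefficients of `y` up to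
degree `n`. -/
theorem iteratedDeriv_lift_velocity_congr (hf : ContDiff ℝ ∞ f) (x₀ : Fin l → ℝ)
    (y₀ : Fin p → ℝ) (a : Fin r → (Fin l → ℝ)) {b b' : Fin r → (Fin p → ℝ)} {n : ℕ}
    (h : ∀ j : Fin r, (j : ℕ) < n → b j = b' j) :
    iteratedDeriv n
        (fun t => f (polyCurve x₀ a t, polyCurve y₀ b t) (deriv (polyCurve x₀ a) t)) 0 =
      iteratedDeriv n
        (fun t => f (polyCurve x₀ a t, polyCurve y₀ b' t) (deriv (polyCurve x₀ a) t)) 0 := by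
  have hx := contDiff_polyCurve x₀ a
  have hx' : ContDiff ℝ ∞ (deriv (polyCurve x₀ a)) :=
    (contDiff_deriv_polyCurve x₀).comp (contDiff_prodMk_right a)
  have hy := contDiff_polyCurve (r := r) y₀
  have hg : ContDiff ℝ ∞ fun q : ((Fin l → ℝ) × (Fin p → ℝ)) × (Fin l → ℝ) => f q.1 q.2 :=
    (hf.comp contDiff_fst).clm_apply contDiff_snd
  refine DFunLike.congr_fun (iteratedFDeriv_comp_congr (n := n) (x := (0 : ℝ)) hg
    ((hx.prodMk (hy b)).prodMk hx') ((hx.prodMk (hy b')).prodMk hx') fun k hk => ?_) fun _ => 1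
  have hk' : (k : ℕ∞ω) ≤ ∞ := by exact_mod_cast le_top
  rw [iteratedFDeriv_prodMk (hx.prodMk (hy b)).contDiffAt hx'.contDiffAt hk',
    iteratedFDeriv_prodMk (hx.prodMk (hy b')).contDiffAt hx'.contDiffAt hk',
    iteratedFDeriv_prodMk hx.contDiffAt (hy b).contDiffAt hk',
    iteratedFDeriv_prodMk hx.contDiffAt (hy b').contDiffAt hk',
    iteratedFDeriv_polyCurve_congr y₀ h hk]

/-- The recursion that determines the coefficients of a jet lift. -/
theorem IsJetLift.factorial_smul_eq (hf : ContDiff ℝ ∞ f) {x₀ : Fin l → ℝ} {y₀ : Fin p → ℝ}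
    {a : Fin r → (Fin l → ℝ)} {b : Fin r → (Fin p → ℝ)} (h : IsJetLift f x₀ y₀ r a b)
    (j : Fin r) :
    (((j : ℕ) + 1).factorial : ℝ) • b j =
      iteratedDeriv j
        (fun t => f (polyCurve x₀ a t, polyCurve y₀ b t) (deriv (polyCurve x₀ a) t)) 0 := by
  have hy' : ContDiff ℝ ∞ (deriv (polyCurve y₀ b)) :=
    (contDiff_deriv_polyCurve y₀).comp (contDiff_prodMk_right b)
  have hv : ContDiff ℝ ∞
      fun t => f (polyCurve x₀ a t, polyCurve y₀ b t) (deriv (polyCurve x₀ a) t) :=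
    (contDiff_uncurry_lift_velocity hf x₀ y₀).comp (contDiff_prodMk_right (a, b))
  have hn : ((j : ℕ) : ℕ∞ω) ≤ ∞ := by exact_mod_cast le_top
  have h0 := h j j.isLt
  rw [iteratedDeriv_fun_sub (hy'.of_le hn).contDiffAt (hv.of_le hn).contDiffAt, sub_eq_zero,
    ← iteratedDeriv_succ', iteratedDeriv_succ_polyCurve_zero] at h0
  simpa [Fin.val_inj] using h0

theorem contDiff_of_isJetLift (hf : ContDiff ℝ ∞ f) {x₀ : Fin l → ℝ} {y₀ : Fin p → ℝ}
    {J : (Fin r → (Fin l → ℝ)) → (Fin r → (Fin p → ℝ))}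
    (hJ : ∀ a, IsJetLift f x₀ y₀ r a (J a)) : ContDiff ℝ ∞ J := by
  suffices h : ∀ (n : ℕ) (j : Fin r), (j : ℕ) = n → ContDiff ℝ ∞ fun a => J a j from
    contDiff_pi.2 fun j => h j j rfl
  intro n
  induction n using Nat.strong_induction_on with
  | _ n ih =>
    rintro j rfl
    have hT : ContDiff ℝ ∞ fun a => fun i : Fin r => if i < j then J a i else 0 := by
      refine contDiff_pi.2 fun i => ?_
      split_ifs with hi
      · exact ih i hi i rfl
      · exact contDiff_const
    have hrec : (fun a => J a j) = fun a => (((j : ℕ) + 1).factorial : ℝ)⁻¹ •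
        iteratedDeriv j (fun t =>
          f (polyCurve x₀ a t, polyCurve y₀ (fun i => if i < j then J a i else 0) t)
            (deriv (polyCurve x₀ a) t)) 0 := by
      funext a
      rw [eq_inv_smul_iff₀ (by positivity), (hJ a).factorial_smul_eq hf j]
      exact iteratedDeriv_lift_velocity_congr hf x₀ y₀ a fun i hi =>
        (if_pos (Fin.lt_def.2 hi)).symm
    rw [hrec]
    exact (((contDiff_uncurry_lift_velocity hf x₀ y₀).iteratedDeriv_uncurry j).comp
      ((contDiff_id.prodMk hT).prodMk contDiff_const)).const_smul _

end JetLift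

/-- With `J` the jet-lifting map at `(x₀, y₀)` and
`H = {(a,b) : the curve (x₀ + ∑ aⱼ tʲ, y₀ + ∑ bⱼ tʲ) is horizontal to order r at 0}`:
`H` equals the graph of `J`; in particular (since `J` is smooth) `H` is a smooth submanifold
of `(ℝ^l)^r × (ℝ^p)^r` of dimension `l·r`, and the projection `(a,b) ↦ a` restricts to a
homeomorphism from `H` onto `(ℝ^l)^r`. -/
theorem horizontal_jets_graph_of_jet_lift
    (l p : ℕ) (hl : 1 ≤ l) (hp : 1 ≤ p)
    (f : (Fin l → ℝ) × (Fin p → ℝ) → ((Fin l → ℝ) →L[ℝ] (Fin p → ℝ)))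
    (hf : ContDiff ℝ (⊤ : ℕ∞) f)
    (x₀ : Fin l → ℝ) (y₀ : Fin p → ℝ) (r : ℕ) (hr : 1 ≤ r)
    (J : (Fin r → (Fin l → ℝ)) → (Fin r → (Fin p → ℝ)))
    (hJ : ∀ a, IsJetLift f x₀ y₀ r a (J a) ∧
      ∀ b, IsJetLift f x₀ y₀ r a b → b = J a)
    (H : Set ((Fin r → (Fin l → ℝ)) × (Fin r → (Fin p → ℝ))))
    (hH : H = {z | IsJetLift f x₀ y₀ r z.1 z.2}) :
    H = {z | z.2 = J z.1} ∧
    ContDiff ℝ (⊤ : ℕ∞) J ∧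
    Module.finrank ℝ (Fin r → (Fin l → ℝ)) = l * r ∧
    ∃ e : ↥H ≃ₜ (Fin r → (Fin l → ℝ)),
      ∀ z : ↥H, e z = (z : (Fin r → (Fin l → ℝ)) × (Fin r → (Fin p → ℝ))).1 := by
  have hsmooth : ContDiff ℝ ∞ J := contDiff_of_isJetLift hf fun a => (hJ a).1
  have hgraph : H = {z | z.2 = J z.1} := by
    ext z
    rw [hH]
    refine ⟨fun h => (hJ z.1).2 z.2 h, fun h => ?_⟩
    change IsJetLift f x₀ y₀ r z.1 z.2
    rw [show z.2 = J z.1 from h]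
    exact (hJ z.1).1
  refine ⟨hgraph, hsmooth, ?_, ?_⟩
  · rw [Module.finrank_pi_fintype]
    simp [mul_comm]
  · refine ⟨{ toFun := fun z => z.1.1
              invFun := fun a => ⟨(a, J a), hgraph ▸ rfl⟩
              left_inv := fun z => ?_
              right_inv := fun _ => rfl
              continuous_toFun := by fun_prop
              continuous_invFun := ?_ }, fun _ => rfl⟩
    · have hz : z.1.2 = J z.1.1 := hgraph.subset z.2
      exact Subtype.ext (Prod.ext rfl hz.symm)
    · exact (continuous_id.prodMk hsmooth.continuous).subtype_mk _
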